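/- arXiv:1703.04248 — 3 statements merged into one kernel-verified Lean document; each statement's English description precedes it below -/
import Mathlib

section
/- Let k ≥ 1, let b_1, …, b_k be nonnegative integers, let n_1, …, n_k be integers, and let n ≥ 1 be an integer. Assume that for every odd integer m with 1 ≤ m ≤ 2n−1 one has Σ_{i=1}^k n_i·b_i^m = 0. Then for all sufficiently large primes p, the rational number ∏_{i=1}^k ((b_i·p)!)^{n_i} − ∏_{i=1}^k (b_i!)^{n_i} is either zero or has p-adic valuation at least 2n+1 (i.e. the supercongruence ∏_{i=1}^k ((b_i p)!)^{n_i} ≡ ∏_{i=1}^k (b_i!)^{n_i} mod p^{2n+1} holds). -/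
open Finset

section WeightedProd

variable {ι M M' : Type*} [Fintype ι] [CommMonoid M] [CommMonoid M']

/-- The product of `f j ^ e i` over all `i` and all `j < b i`. -/
def weightedProd (b e : ι → ℕ) (f : ℕ → M) : M :=
  ∏ i, ∏ j ∈ range (b i), f j ^ e i

theorem weightedProd_mul (b e : ι → ℕ) (f g : ℕ → M) :
    weightedProd b e (fun j => f j * g j) = weightedProd b e f * weightedProd b e g := by
  simp only [weightedProd, mul_pow, prod_mul_distrib]

theorem weightedProd_const (b e : ι → ℕ) (x : M) :
    weightedProd b e (fun _ => x) = x ^ ∑ i, e i * b i := by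
  simp only [weightedProd, prod_const, card_range, ← pow_mul, prod_pow_eq_pow_sum]

theorem weightedProd_prod {κ : Type*} (b e : ι → ℕ) (s : Finset κ) (f : κ → ℕ → M) :
    weightedProd b e (fun j => ∏ a ∈ s, f a j) = ∏ a ∈ s, weightedProd b e (f a) := by
  classical
  induction s using Finset.induction_on with
  | empty => simp [weightedProd]
  | insert a s ha ih => simp only [prod_insert ha, weightedProd_mul, ih]

theorem map_weightedProd {F : Type*} [FunLike F M M'] [MonoidHomClass F M M'] (φ : F)
    (b e : ι → ℕ) (f : ℕ → M) :
    φ (weightedProd b e f) = weightedProd b e (fun j => φ (f j)) := by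
  simp only [weightedProd, map_prod, map_pow]

end WeightedProd

section LogDerivative

open PowerSeries

theorem derivative_pow_eq_mul {f h : ℤ⟦X⟧} (hf : d⁄dX ℤ f = f * h) (e : ℕ) :
    d⁄dX ℤ (f ^ e) = f ^ e * (e * h) := by
  induction e with
  | zero => simp
  | succ e ih =>
    rw [pow_succ, Derivation.leibniz, ih, hf]
    simp only [smul_eq_mul]
    push_cast
    ring

theorem derivative_prod_eq_mul {κ : Type*} (s : Finset κ) (f h : κ → ℤ⟦X⟧)
    (hf : ∀ i ∈ s, d⁄dX ℤ (f i) = f i * h i) :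
    d⁄dX ℤ (∏ i ∈ s, f i) = (∏ i ∈ s, f i) * ∑ i ∈ s, h i := by
  classical
  induction s using Finset.induction_on with
  | empty => simp
  | insert a s ha ih =>
    rw [prod_insert ha, sum_insert ha, Derivation.leibniz,
      ih fun i hi => hf i (mem_insert_of_mem hi), hf a (mem_insert_self a s)]
    simp only [smul_eq_mul]
    ring

theorem derivative_weightedProd {ι : Type*} [Fintype ι] (b e : ι → ℕ) (f h : ℕ → ℤ⟦X⟧)
    (hf : ∀ j, d⁄dX ℤ (f j) = f j * h j) :
    d⁄dX ℤ (weightedProd b e f) =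
      weightedProd b e f * ∑ i, ∑ j ∈ range (b i), (e i : ℤ⟦X⟧) * h j :=
  derivative_prod_eq_mul _ _ _ fun _ _ =>
    derivative_prod_eq_mul _ _ _ fun j _ => derivative_pow_eq_mul (hf j) _

/-- Two power series with the same constant term whose logarithmic derivatives agree to order
`n - 1` agree to order `n`. -/
theorem coeff_eq_of_derivative_eq_mul {f g h₁ h₂ : ℤ⟦X⟧} (n : ℕ)
    (hf : d⁄dX ℤ f = f * h₁) (hg : d⁄dX ℤ g = g * h₂) (h0 : coeff 0 f = coeff 0 g)
    (hh : ∀ r, r + 1 < n → coeff r h₁ = coeff r h₂) (m : ℕ) (hm : m < n) :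
    coeff m f = coeff m g := by
  induction m using Nat.strong_induction_on with
  | _ m ih =>
    rcases m with _ | m
    · exact h0
    · have key : coeff m (f * h₁) = coeff m (g * h₂) := by
        rw [coeff_mul, coeff_mul]
        refine sum_congr rfl fun x hx => ?_
        have := mem_antidiagonal.mp hx
        rw [ih x.1 (by omega) (by omega), hh x.2 (by omega)]
      rw [← hf, ← hg, coeff_derivative, coeff_derivative] at key
      exact mul_right_cancel₀ (by positivity) key

theorem derivative_one_add_C_mul_X (t : ℤ) :
    d⁄dX ℤ (1 + C t * X : ℤ⟦X⟧) =
      (1 + C t * X) * PowerSeries.mk fun r => (-1) ^ r * t ^ (r + 1) := by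
  rw [map_add, Derivation.leibniz, derivative_X, Derivation.map_one_eq_zero, derivative_C]
  simp only [smul_eq_mul, mul_one, mul_zero, add_zero, zero_add]
  ext r
  rcases r with _ | r
  · simp only [coeff_zero_eq_constantCoeff_apply, map_mul, map_add, constantCoeff_C,
      constantCoeff_X, map_one, mul_zero, add_zero, one_mul]
    simp [← coeff_zero_eq_constantCoeff_apply]
  · rw [add_mul, one_mul, mul_assoc, map_add, coeff_C_mul, coeff_succ_X_mul, coeff_mk, coeff_mk,
      coeff_C, if_neg (by omega)]
    ring

end LogDerivative

/-- Products of linear polynomials `1 + t j X` whose exponents have equal power sums of order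
below `n` agree modulo `X ^ n`. -/
theorem X_pow_dvd_weightedProd_sub {ι : Type*} [Fintype ι] (b e₁ e₂ : ι → ℕ) (t : ℕ → ℤ)
    (n : ℕ)
    (h : ∀ r, 1 ≤ r → r < n →
      ∑ i, ((e₁ i : ℤ) - e₂ i) * ∑ j ∈ range (b i), t j ^ r = 0) :
    (Polynomial.X ^ n : Polynomial ℤ) ∣
      weightedProd b e₁ (fun j => 1 + Polynomial.C (t j) * Polynomial.X) -
        weightedProd b e₂ (fun j => 1 + Polynomial.C (t j) * Polynomial.X) := by
  rw [Polynomial.X_pow_dvd_iff]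
  intro m hm
  have coe_eq (e : ι → ℕ) :
      ((weightedProd b e (fun j => 1 + Polynomial.C (t j) * Polynomial.X) :
        Polynomial ℤ) : PowerSeries ℤ) =
      weightedProd b e (fun j => 1 + PowerSeries.C (t j) * PowerSeries.X) := by
    rw [← Polynomial.coeToPowerSeries.ringHom_apply, map_weightedProd]
    simp only [map_add, map_one, map_mul, Polynomial.coeToPowerSeries.ringHom_apply,
      Polynomial.coe_C, Polynomial.coe_X]
  rw [Polynomial.coeff_sub, ← Polynomial.coeff_coe, ← Polynomial.coeff_coe, coe_eq, coe_eq,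
    sub_eq_zero]
  refine coeff_eq_of_derivative_eq_mul n
    (derivative_weightedProd b e₁ _ _ fun j => derivative_one_add_C_mul_X (t j))
    (derivative_weightedProd b e₂ _ _ fun j => derivative_one_add_C_mul_X (t j)) ?_ ?_ m hm
  · simp only [PowerSeries.coeff_zero_eq_constantCoeff_apply, map_weightedProd]
    simp [weightedProd]
  · intro r hr
    have coeff_eq (e : ι → ℕ) : PowerSeries.coeff r (∑ i, ∑ j ∈ range (b i),
        (e i : PowerSeries ℤ) * PowerSeries.mk fun r => (-1) ^ r * t j ^ (r + 1)) =
        (-1) ^ r * ∑ i, (e i : ℤ) * ∑ j ∈ range (b i), t j ^ (r + 1) := by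
      simp only [map_sum, mul_sum, ← map_natCast (PowerSeries.C (R := ℤ)),
        PowerSeries.coeff_C_mul, PowerSeries.coeff_mk]
      exact sum_congr rfl fun i _ => sum_congr rfl fun j _ => by ring
    have := h (r + 1) (by omega) hr
    simp only [sub_mul, sum_sub_distrib] at this
    rw [coeff_eq, coeff_eq, sub_eq_zero.mp this]

section PowerSums

theorem sum_range_two_mul {M : Type*} [AddCommMonoid M] (f : ℕ → M) (m : ℕ) :
    ∑ l ∈ range (2 * m), f l = ∑ l ∈ range m, (f (2 * l) + f (2 * l + 1)) := by
  induction m with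
  | zero => simp
  | succ m ih => rw [mul_add, mul_one, sum_range_succ, sum_range_succ, ih, sum_range_succ, add_assoc]

theorem add_one_pow_sub_sub_one_pow (s : ℤ) (r : ℕ) :
    (s + 1) ^ (2 * r + 1) - (s - 1) ^ (2 * r + 1) =
      ∑ l ∈ range (r + 1), 2 * ((2 * r + 1).choose (2 * l) : ℤ) * s ^ (2 * l) := by
  rw [sub_eq_add_neg s 1, add_pow, add_pow, ← sum_sub_distrib,
    show 2 * r + 1 + 1 = 2 * (r + 1) by ring, sum_range_two_mul]
  refine sum_congr rfl fun l hl => ?_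
  have hl' : l ≤ r := by simpa [Nat.lt_succ_iff] using hl
  rw [show 2 * r + 1 - 2 * l = 2 * (r - l) + 1 by omega,
    show 2 * r + 1 - (2 * l + 1) = 2 * (r - l) by omega]
  simp only [pow_succ, pow_mul, one_pow]
  ring

theorem two_mul_pow_eq_sum (B r : ℕ) :
    (2 * (B : ℤ)) ^ (2 * r + 1) = ∑ l ∈ range (r + 1),
      2 * ((2 * r + 1).choose (2 * l) : ℤ) * ∑ j ∈ range B, (2 * (j : ℤ) + 1) ^ (2 * l) := by
  induction B with
  | zero => simp
  | succ B ih =>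
    simp only [sum_range_succ _ B, mul_add, sum_add_distrib]
    rw [← ih, ← add_one_pow_sub_sub_one_pow]
    push_cast
    ring

/-- Vanishing of odd moments of `b` passes to the sums of even powers of the first odd numbers. -/
theorem sum_mul_sum_odd_pow_eq_zero {ι : Type*} [Fintype ι] (b : ι → ℕ) (c : ι → ℤ) (n : ℕ)
    (h : ∀ r < n, ∑ i, c i * (b i : ℤ) ^ (2 * r + 1) = 0) (r : ℕ) (hr : r < n) :
    ∑ i, c i * ∑ j ∈ range (b i), (2 * (j : ℤ) + 1) ^ (2 * r) = 0 := by
  induction r using Nat.strong_induction_on with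
  | _ r ih =>
    have h1 : ∑ i, c i * (2 * (b i : ℤ)) ^ (2 * r + 1) = 0 := by
      simp only [mul_pow, mul_left_comm _ ((2 : ℤ) ^ _), ← mul_sum, h r hr, mul_zero]
    simp only [two_mul_pow_eq_sum, mul_sum (range (r + 1))] at h1
    rw [sum_comm, sum_range_succ] at h1
    simp only [mul_left_comm (c _), ← mul_sum univ] at h1
    rw [sum_eq_zero fun l hl => by
      rw [ih l (mem_range.mp hl) ((mem_range.mp hl).trans hr), mul_zero], zero_add] at h1
    refine (mul_eq_zero.mp h1).resolve_left ?_
    have := Nat.choose_pos (show 2 * r ≤ 2 * r + 1 by omega)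
    positivity

end PowerSums

section Block

/-- The product of the integers strictly between `j * p` and `(j + 1) * p`. -/
def blockProd (p j : ℕ) : ℕ := ∏ i ∈ range (p - 1), (j * p + (i + 1))

theorem factorial_mul_eq (p : ℕ) (hp : 0 < p) (B : ℕ) :
    (B * p).factorial = B.factorial * (p ^ B * ∏ j ∈ range B, blockProd p j) := by
  induction B with
  | zero => simp
  | succ B ih =>
    obtain ⟨q, rfl⟩ : ∃ q, p = q + 1 := ⟨p - 1, by omega⟩
    rw [add_mul, one_mul, ← Nat.factorial_mul_ascFactorial, Nat.ascFactorial_eq_prod_range,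
      prod_range_succ, ih, prod_range_succ _ B, Nat.factorial_succ]
    have : ∏ i ∈ range q, (B * (q + 1) + 1 + i) = blockProd (q + 1) B :=
      prod_congr rfl fun i _ => by ring
    rw [this]
    ring

theorem blockProd_modEq (p j : ℕ) : blockProd p j ≡ blockProd p 0 [MOD p] := by
  unfold blockProd
  induction range (p - 1) using Finset.induction_on with
  | empty => rfl
  | insert i s hi ih =>
    rw [prod_insert hi, prod_insert hi]
    exact Nat.ModEq.mul (by simp [Nat.ModEq]) ih

theorem not_dvd_blockProd {p : ℕ} (hp : p.Prime) (j : ℕ) : ¬ p ∣ blockProd p j := by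
  rw [blockProd, hp.prime.dvd_finsetProd_iff]
  rintro ⟨i, hi, hd⟩
  have h1 := (Nat.dvd_add_right (Dvd.intro_left j rfl)).mp hd
  have h2 := Nat.le_of_dvd (by omega) h1
  have := mem_range.mp hi
  omega

/-- Pairing `a` with `p - a` writes the square of a block as a product of differences of squares. -/
theorem four_pow_mul_blockProd_sq (p j : ℕ) :
    (4 : ℤ) ^ (p - 1) * (blockProd p j : ℤ) ^ 2 =
      ∏ i ∈ range (p - 1), ((2 * (j : ℤ) + 1) ^ 2 * p ^ 2 - (p - 2 * ((i : ℤ) + 1)) ^ 2) := by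
  have h1 : (blockProd p j : ℤ) = ∏ i ∈ range (p - 1), ((j : ℤ) * p + (i + 1)) := by
    simp [blockProd]
  have h2 : (blockProd p j : ℤ) = ∏ i ∈ range (p - 1), ((j : ℤ) * p + (p - (i + 1))) := by
    rw [h1, ← prod_range_reflect]
    refine prod_congr rfl fun i hi => ?_
    have := mem_range.mp hi
    have : ((p - 1 - 1 - i : ℕ) : ℤ) = p - 1 - 1 - i := by omega
    rw [this]
    ring
  have h3 : (4 : ℤ) ^ (p - 1) = ∏ i ∈ range (p - 1), (4 : ℤ) := by simp
  rw [sq, h3]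
  nth_rewrite 1 [h1]
  rw [h2, ← prod_mul_distrib, ← prod_mul_distrib]
  exact prod_congr rfl fun i _ => by ring

end Block

theorem prod_add_mul_eq {R κ : Type*} [CommRing R] (s : Finset κ) (t : R) (y z : κ → R)
    (ht : t * t = 0) (hy : ∀ a ∈ s, t * y a = t) :
    ∏ a ∈ s, (y a + t * z a) = ∏ a ∈ s, y a + t * ∑ a ∈ s, z a := by
  classical
  induction s using Finset.induction_on with
  | empty => simp
  | insert a s ha ih =>
    have hs : ∀ x ∈ s, t * y x = t := fun x hx => hy x (mem_insert_of_mem hx)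
    have hprod : t * ∏ x ∈ s, y x = t := by
      refine Finset.prod_induction y (fun x => t * x = t) (fun u v hu hv => ?_) (mul_one t) hs
      rw [← mul_assoc, hu, hv]
    rw [prod_insert ha, prod_insert ha, sum_insert ha, ih hs]
    linear_combination (z a * ∑ x ∈ s, z x) * ht + z a * hprod +
      (∑ x ∈ s, z x) * hy a (mem_insert_self a s)

theorem sum_range_natCast_zmod {M : Type*} [AddCommMonoid M] (p : ℕ) [NeZero p]
    (f : ZMod p → M) : ∑ a ∈ range p, f a = ∑ x : ZMod p, f x := by
  refine sum_nbij' (fun a => (a : ZMod p)) ZMod.val (by simp) ?_ ?_ (by simp) (by simp)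
  · intro x _
    simpa using ZMod.val_lt x
  · intro a ha
    exact ZMod.val_cast_of_lt (mem_range.mp ha)

theorem sum_inv_two_mul_pow_eq_zero (p : ℕ) [Fact p.Prime] (hp2 : p ≠ 2) (m : ℕ) (hm : m ≠ 0)
    (hmp : m < p - 1) :
    ∑ i ∈ range (p - 1), (((p : ZMod p) - 2 * ((i : ZMod p) + 1))⁻¹) ^ m = 0 := by
  have hp : p.Prime := Fact.out
  have two_ne : (-2 : ZMod p) ≠ 0 := by
    rw [neg_ne_zero]
    exact_mod_cast (ZMod.natCast_eq_zero_iff 2 p).not.mpr fun h =>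
      hp2 ((Nat.prime_dvd_prime_iff_eq hp Nat.prime_two).mp h)
  have h1 := sum_range_natCast_zmod p fun x => ((-2 * x)⁻¹) ^ m
  rw [show range p = range (p - 1 + 1) by rw [Nat.sub_add_cancel hp.one_le],
    sum_range_succ'] at h1
  have h2 : ∑ x : ZMod p, ((-2 * x)⁻¹) ^ m = ∑ x : ZMod p, x ^ m :=
    Fintype.sum_equiv ((Equiv.mulLeft₀ _ two_ne).trans (Equiv.inv (ZMod p))) _ _
      fun x => by simp
  rw [h2, FiniteField.sum_pow_lt_card_sub_one _ m (by simpa using hmp)] at h1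
  simpa [hm] using h1

theorem natCast_dvd_of_castHom_eq_zero {p N : ℕ} [NeZero N] (hd : p ∣ N) (x : ZMod N)
    (hx : ZMod.castHom hd (ZMod p) x = 0) : (p : ZMod N) ∣ x := by
  rw [← ZMod.natCast_zmod_val x, map_natCast, ZMod.natCast_eq_zero_iff] at hx
  rw [← ZMod.natCast_zmod_val x]
  exact_mod_cast (Nat.cast_dvd_cast hx : ((p : ℕ) : ZMod N) ∣ (x.val : ZMod N))

theorem isUnit_intCast_zmod_prime_pow {p : ℕ} (hp : p.Prime) (m : ℕ) (a : ℤ)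
    (ha : ¬ (p : ℤ) ∣ a) : IsUnit (a : ZMod (p ^ m)) := by
  have : IsCoprime a ((p ^ m : ℕ) : ℤ) := by
    push_cast
    exact (((Nat.prime_iff_prime_int.mp hp).coprime_iff_not_dvd.mpr ha).symm).pow_right
  obtain ⟨u, v, huv⟩ := this
  refine IsUnit.of_mul_eq_one (u : ZMod (p ^ m)) ?_
  have := congrArg (Int.cast : ℤ → ZMod (p ^ m)) huv
  push_cast at this
  rw [← Nat.cast_pow, ZMod.natCast_self, mul_zero, add_zero] at this
  rw [mul_comm, this]

theorem not_dvd_sub_two_mul {p : ℕ} (hp : p.Prime) (hp2 : p ≠ 2) {i : ℕ} (hi : i < p - 1) :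
    ¬ (p : ℤ) ∣ p - 2 * ((i : ℤ) + 1) := by
  rw [dvd_sub_right (dvd_refl _)]
  intro hd
  have hd' : p ∣ 2 * (i + 1) := by exact_mod_cast hd
  rcases hp.dvd_mul.mp hd' with h | h
  · exact hp2 ((Nat.prime_dvd_prime_iff_eq hp Nat.prime_two).mp h)
  · have := Nat.le_of_dvd (by omega) h
    omega

/-- The squares of the weighted block products agree in every ring that behaves like
`ℤ / p ^ (2 * n + 1)`. -/
theorem weightedProd_blockProd_sq_eq {ι R : Type*} [Fintype ι] [CommRing R] (b e₁ e₂ : ι → ℕ) (n : ℕ)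
    (hn : 1 ≤ n)
    (h : ∀ r < n, ∑ i, ((e₁ i : ℤ) - e₂ i) * (b i : ℤ) ^ (2 * r + 1) = 0)
    (hdeg : ∑ i, e₁ i * b i = ∑ i, e₂ i * b i)
    (p : ℕ) (hp : p.Prime) (hnp : 2 * n + 1 < p) (hpow : (p : R) ^ (2 * n + 1) = 0)
    (hunit : ∀ a : ℤ, ¬ (p : ℤ) ∣ a → IsUnit (a : R))
    (φ : R →+* ZMod p) (hφ : ∀ y, φ y = 0 → (p : R) ∣ y) :
    weightedProd b e₁ (fun j => (blockProd p j : R) ^ 2) =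
      weightedProd b e₂ (fun j => (blockProd p j : R) ^ 2) := by
  have : Fact p.Prime := ⟨hp⟩
  have hp2 : p ≠ 2 := by omega
  set α : ℕ → ℤ := fun i => p - 2 * ((i : ℤ) + 1) with hα
  have hαunit : ∀ i ∈ range (p - 1), IsUnit (α i : R) := fun i hi =>
    hunit _ (not_dvd_sub_two_mul hp hp2 (mem_range.mp hi))
  have hinv : ∀ i, ∃ v : R, i ∈ range (p - 1) → (α i : R) * v = 1 := fun i => by
    by_cases hi : i ∈ range (p - 1)
    · obtain ⟨v, hv⟩ := (hαunit i hi).exists_right_inv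
      exact ⟨v, fun _ => hv⟩
    · exact ⟨0, fun hi' => absurd hi' hi⟩
  choose v hv using hinv
  set L : ℕ → Polynomial ℤ :=
    fun j => 1 + Polynomial.C (-(2 * (j : ℤ) + 1) ^ 2) * Polynomial.X with hL
  set x : ℕ → R := fun i => (p : R) ^ 2 * v i ^ 2 with hx
  set K : R := ∏ i ∈ range (p - 1), -(α i : R) ^ 2 with hK
  have hblock (j : ℕ) : (4 : R) ^ (p - 1) * (blockProd p j : R) ^ 2 =
      K * ∏ i ∈ range (p - 1), Polynomial.aeval (x i) (L j) := by
    have := congrArg (Int.cast : ℤ → R) (four_pow_mul_blockProd_sq p j)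
    push_cast at this
    rw [this, hK, ← prod_mul_distrib]
    refine prod_congr rfl fun i hi => ?_
    have hvi := hv i hi
    simp only [hα, hL, hx] at hvi ⊢
    rw [map_add, map_one, map_mul, Polynomial.aeval_C, Polynomial.aeval_X, algebraMap_int_eq,
      eq_intCast]
    push_cast at hvi ⊢
    linear_combination (-(2 * (j : R) + 1) ^ 2 * (p : R) ^ 2 *
      (((p : R) - 2 * ((i : R) + 1)) * v i + 1)) * hvi
  have hweighted (e : ι → ℕ) : ((4 : R) ^ (p - 1)) ^ (∑ i, e i * b i) *
      weightedProd b e (fun j => (blockProd p j : R) ^ 2) =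
      K ^ (∑ i, e i * b i) *
        ∏ i ∈ range (p - 1), Polynomial.aeval (x i) (weightedProd b e L) := by
    rw [← weightedProd_const, ← weightedProd_mul, funext hblock, weightedProd_mul,
      weightedProd_const, weightedProd_prod]
    simp only [map_weightedProd]
  obtain ⟨E, hE⟩ : (Polynomial.X ^ n : Polynomial ℤ) ∣
      weightedProd b e₁ L - weightedProd b e₂ L := by
    refine X_pow_dvd_weightedProd_sub b e₁ e₂ _ n fun r _ hrn => ?_
    have := sum_mul_sum_odd_pow_eq_zero b (fun i => (e₁ i : ℤ) - e₂ i) n h r hrn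
    rw [← mul_zero ((-1 : ℤ) ^ r), ← this, mul_sum]
    refine sum_congr rfl fun i _ => ?_
    rw [mul_left_comm, mul_sum _ _ ((-1 : ℤ) ^ r)]
    congr 1
    exact sum_congr rfl fun j _ => by rw [neg_pow, pow_mul]
  have hpx (i : ℕ) : (p : R) ∣ x i := ⟨p * v i ^ 2, by simp only [hx]; ring⟩
  have heval (Q : Polynomial ℤ) (i : ℕ) :
      (p : R) ^ (2 * n) * Polynomial.aeval (x i) Q = (p : R) ^ (2 * n) * (Q.eval 0 : ℤ) := by
    have h1 : x i ∣ Polynomial.aeval (x i) Q - ((Q.eval 0 : ℤ) : R) := by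
      have := Polynomial.sub_dvd_eval_sub (x i) 0 (Q.map (algebraMap ℤ R))
      rw [sub_zero, Polynomial.eval_map_algebraMap] at this
      simpa [Polynomial.eval_zero_map] using this
    obtain ⟨d, hd⟩ := (hpx i).trans h1
    linear_combination (p : R) ^ (2 * n) * hd + d * hpow
  have hsum : (p : R) ^ (2 * n) * ∑ i ∈ range (p - 1), v i ^ (2 * n) = 0 := by
    obtain ⟨d, hd⟩ : (p : R) ∣ ∑ i ∈ range (p - 1), v i ^ (2 * n) := by
      refine hφ _ ?_
      rw [map_sum, ← sum_inv_two_mul_pow_eq_zero p hp2 (2 * n) (by omega) (by omega)]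
      refine sum_congr rfl fun i hi => ?_
      have := congrArg φ (hv i hi)
      rw [map_mul, map_one, map_intCast] at this
      rw [map_pow, eq_inv_of_mul_eq_one_right this]
      simp [hα]
    rw [hd]
    linear_combination d * hpow
  have hprod : ∏ i ∈ range (p - 1), Polynomial.aeval (x i) (weightedProd b e₁ L) =
      ∏ i ∈ range (p - 1), Polynomial.aeval (x i) (weightedProd b e₂ L) := by
    have hstep (i : ℕ) : Polynomial.aeval (x i) (weightedProd b e₁ L) =
        Polynomial.aeval (x i) (weightedProd b e₂ L) +
          (p : R) ^ (2 * n) * ((E.eval 0 : ℤ) * v i ^ (2 * n)) := by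
      have h1 := congrArg (Polynomial.aeval (x i)) hE
      rw [map_sub, map_mul, map_pow, Polynomial.aeval_X] at h1
      have h2 := heval E i
      have h3 : x i ^ n = (p : R) ^ (2 * n) * v i ^ (2 * n) := by
        simp only [hx, mul_pow, ← pow_mul]
      rw [h3] at h1
      linear_combination h1 + v i ^ (2 * n) * h2
    simp only [hstep]
    rw [prod_add_mul_eq, ← mul_sum, mul_left_comm, hsum, mul_zero, add_zero]
    · rw [← pow_add, show 2 * n + 2 * n = 2 * n + 1 + (2 * n - 1) by omega, pow_add, hpow,
        zero_mul]
    · intro i _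
      have h0 : (weightedProd b e₂ L).eval 0 = 1 := by
        rw [← Polynomial.coe_evalRingHom, map_weightedProd]
        simp [hL, weightedProd]
      rw [heval, h0, Int.cast_one, mul_one]
  have h4 : IsUnit (((4 : R) ^ (p - 1)) ^ (∑ i, e₂ i * b i)) := by
    have : IsUnit ((4 : ℤ) : R) := hunit _ fun h4 => by
      have h4' : p ∣ 2 ^ 2 := by exact_mod_cast h4
      exact hp2 ((Nat.prime_dvd_prime_iff_eq hp Nat.prime_two).mp (hp.dvd_of_dvd_pow h4'))
    push_cast at this
    exact (this.pow _).pow _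
  refine h4.mul_left_cancel ?_
  rw [hweighted e₂, ← hprod, ← hdeg, hweighted e₁]

theorem weightedProd_blockProd_modEq {ι : Type*} [Fintype ι] (b e : ι → ℕ) (p : ℕ) :
    weightedProd b e (blockProd p) ≡ blockProd p 0 ^ (∑ i, e i * b i) [MOD p] := by
  rw [← ZMod.natCast_eq_natCast_iff, ← Nat.coe_castRingHom, map_weightedProd,
    Nat.coe_castRingHom, Nat.cast_pow, ← weightedProd_const]
  congr 1
  funext j
  exact (ZMod.natCast_eq_natCast_iff _ _ _).mpr (blockProd_modEq p j)

theorem not_dvd_weightedProd_blockProd {ι : Type*} [Fintype ι] (b e : ι → ℕ) {p : ℕ}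
    (hp : p.Prime) : ¬ p ∣ weightedProd b e (blockProd p) := by
  rw [(weightedProd_blockProd_modEq b e p).dvd_iff dvd_rfl]
  exact fun h => not_dvd_blockProd hp 0 (hp.dvd_of_dvd_pow h)

theorem prime_pow_dvd_weightedProd_blockProd_sub {ι : Type*} [Fintype ι] (b e₁ e₂ : ι → ℕ)
    (n : ℕ) (hn : 1 ≤ n)
    (h : ∀ r < n, ∑ i, ((e₁ i : ℤ) - e₂ i) * (b i : ℤ) ^ (2 * r + 1) = 0)
    (hdeg : ∑ i, e₁ i * b i = ∑ i, e₂ i * b i)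
    (p : ℕ) (hp : p.Prime) (hnp : 2 * n + 1 < p) :
    (p : ℤ) ^ (2 * n + 1) ∣
      ((weightedProd b e₁ (blockProd p) : ℕ) : ℤ) - (weightedProd b e₂ (blockProd p) : ℕ) := by
  set A := weightedProd b e₁ (blockProd p) with hA
  set B := weightedProd b e₂ (blockProd p) with hB
  have hAB : A ≡ B [MOD p] := by
    refine (weightedProd_blockProd_modEq b e₁ p).trans ?_
    rw [hdeg]
    exact (weightedProd_blockProd_modEq b e₂ p).symm
  have hcop : ¬ (p : ℤ) ∣ (A : ℤ) + B := by
    intro hd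
    have hd' : p ∣ A + B := by exact_mod_cast hd
    rw [(hAB.add_right B).dvd_iff dvd_rfl, ← two_mul, hp.dvd_mul] at hd'
    rcases hd' with h2 | hB'
    · have := Nat.le_of_dvd (by omega) h2
      omega
    · exact not_dvd_weightedProd_blockProd b e₂ hp hB'
  have : NeZero p := ⟨hp.ne_zero⟩
  have hd : p ∣ p ^ (2 * n + 1) := dvd_pow_self p (by omega)
  have hsq := weightedProd_blockProd_sq_eq (R := ZMod (p ^ (2 * n + 1))) b e₁ e₂ n hn h hdeg p hp
    hnp (by rw [← Nat.cast_pow, ZMod.natCast_self]) (isUnit_intCast_zmod_prime_pow hp _)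
    (ZMod.castHom hd (ZMod p)) (natCast_dvd_of_castHom_eq_zero hd)
  have hcast (e : ι → ℕ) :
      weightedProd b e (fun j => (blockProd p j : ZMod (p ^ (2 * n + 1))) ^ 2) =
        ((weightedProd b e (blockProd p) : ℕ) : ZMod (p ^ (2 * n + 1))) ^ 2 := by
    simp only [sq, weightedProd_mul]
    rw [← Nat.coe_castRingHom, map_weightedProd]
  rw [hcast, hcast, ← hA, ← hB] at hsq
  have hdvd : (p : ℤ) ^ (2 * n + 1) ∣ ((A : ℤ) + B) * (A - B) := by
    have : (((A : ℤ) + B) * (A - B) : ℤ) = ((A ^ 2 : ℤ) - B ^ 2) := by ring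
    rw [this, ← Nat.cast_pow p, ← ZMod.intCast_zmod_eq_zero_iff_dvd]
    push_cast
    rw [hsq, sub_self]
  refine IsCoprime.dvd_of_dvd_mul_left (IsCoprime.pow_left ?_) hdvd
  exact (Nat.prime_iff_prime_int.mp hp).coprime_iff_not_dvd.mpr hcop

theorem prod_factorial_mul_pow_eq {ι : Type*} [Fintype ι] (b e : ι → ℕ) (p : ℕ) (hp : 0 < p) :
    ∏ i, (b i * p).factorial ^ e i = (∏ i, (b i).factorial ^ e i) *
      (p ^ (∑ i, e i * b i) * weightedProd b e (blockProd p)) := by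
  rw [← prod_pow_eq_pow_sum, weightedProd, ← prod_mul_distrib, ← prod_mul_distrib]
  refine prod_congr rfl fun i _ => ?_
  rw [factorial_mul_eq p hp, mul_pow, mul_pow, ← pow_mul, mul_comm (b i), prod_pow]

theorem prod_zpow_eq_div {ι : Type*} [Fintype ι] (f : ι → ℕ) (hf : ∀ i, f i ≠ 0) (c : ι → ℤ) :
    ∏ i, (f i : ℚ) ^ c i =
      ((∏ i, f i ^ (c i).toNat : ℕ) : ℚ) / (∏ i, f i ^ (-c i).toNat : ℕ) := by
  push_cast
  rw [← prod_div_distrib]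
  refine prod_congr rfl fun i _ => ?_
  rw [← zpow_natCast, ← zpow_natCast, ← zpow_sub₀ (Nat.cast_ne_zero.mpr (hf i))]
  congr 1
  omega

theorem not_dvd_prod_factorial_pow {ι : Type*} [Fintype ι] (b e : ι → ℕ) {p : ℕ} (hp : p.Prime)
    (hb : ∀ i, b i < p) : ¬ p ∣ ∏ i, (b i).factorial ^ e i := by
  rw [hp.prime.dvd_finsetProd_iff]
  rintro ⟨i, _, hi⟩
  have := (hp.dvd_factorial).mp (hp.dvd_of_dvd_pow hi)
  exact absurd (hb i) (by omega)

/-- Granville's supercongruence for products of factorials: if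
`∑ i, n_i * b_i ^ m = 0` for every odd `m` with `1 ≤ m ≤ 2n - 1`, then for all
sufficiently large primes `p` we have
`∏ i, ((b_i * p)!)^(n_i) ≡ ∏ i, (b_i !)^(n_i) (mod p^(2n+1))`. -/
theorem granville_factorial_supercongruence
    (k : ℕ) (hk : 1 ≤ k) (b : Fin k → ℕ) (c : Fin k → ℤ) (n : ℕ) (hn : 1 ≤ n)
    (h : ∀ m : ℕ, Odd m → 1 ≤ m → m ≤ 2 * n - 1 → ∑ i, c i * (b i : ℤ) ^ m = 0) :
    ∃ N : ℕ, ∀ p : ℕ, p.Prime → N ≤ p →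
      (∏ i, ((Nat.factorial (b i * p) : ℚ)) ^ (c i))
          - (∏ i, ((Nat.factorial (b i) : ℚ)) ^ (c i)) = 0 ∨
      (2 * (n : ℤ) + 1) ≤ padicValRat p
        ((∏ i, ((Nat.factorial (b i * p) : ℚ)) ^ (c i))
          - (∏ i, ((Nat.factorial (b i) : ℚ)) ^ (c i))) := by
  refine ⟨2 * n + 2 + ∑ i, (b i + 1), fun p hp hNp => ?_⟩
  have : Fact p.Prime := ⟨hp⟩
  have hb : ∀ i, b i < p := fun i => by
    have := single_le_sum (f := fun i => b i + 1) (fun _ _ => Nat.zero_le _) (mem_univ i)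
    omega
  set e₁ : Fin k → ℕ := fun i => (c i).toNat with he₁
  set e₂ : Fin k → ℕ := fun i => (-c i).toNat with he₂
  have hc (i : Fin k) : c i = (e₁ i : ℤ) - e₂ i := by simp only [he₁, he₂]; omega
  have hmom : ∀ r < n, ∑ i, ((e₁ i : ℤ) - e₂ i) * (b i : ℤ) ^ (2 * r + 1) = 0 := fun r hr => by
    simp only [← hc]
    exact h _ (odd_two_mul_add_one r) (by omega) (by omega)
  have hdeg : ∑ i, e₁ i * b i = ∑ i, e₂ i * b i := by
    have := hmom 0 (by omega)
    simp only [mul_zero, zero_add, pow_one, sub_mul, sum_sub_distrib] at this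
    exact_mod_cast sub_eq_zero.mp this
  have hdvd := prime_pow_dvd_weightedProd_blockProd_sub b e₁ e₂ n hn hmom hdeg p hp (by omega)
  have hB := not_dvd_weightedProd_blockProd b e₂ hp
  have hC := not_dvd_prod_factorial_pow b e₁ hp hb
  have hD := not_dvd_prod_factorial_pow b e₂ hp hb
  rw [prod_zpow_eq_div _ (fun i => Nat.factorial_ne_zero _),
    prod_zpow_eq_div _ (fun i => Nat.factorial_ne_zero _),
    prod_factorial_mul_pow_eq b _ p hp.pos, prod_factorial_mul_pow_eq b _ p hp.pos]
  simp only [← he₁, ← he₂]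
  rw [← hdeg]
  generalize weightedProd b e₁ (blockProd p) = A at *
  generalize weightedProd b e₂ (blockProd p) = B at *
  generalize ∏ i, (b i).factorial ^ e₁ i = C at *
  generalize ∏ i, (b i).factorial ^ e₂ i = D at *
  have hB0 : B ≠ 0 := by rintro rfl; exact hB (dvd_zero p)
  have hC0 : C ≠ 0 := by rintro rfl; exact hC (dvd_zero p)
  have hD0 : D ≠ 0 := by rintro rfl; exact hD (dvd_zero p)
  have hp0 : p ≠ 0 := hp.ne_zero
  have key : ((C * (p ^ (∑ i, e₁ i * b i) * A) : ℕ) : ℚ) / (D * (p ^ (∑ i, e₁ i * b i) * B) : ℕ) -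
      (C : ℚ) / D = (C : ℚ) * (((A : ℤ) - B : ℤ) : ℚ) / ((D * B : ℕ) : ℚ) := by
    push_cast
    field_simp
  rw [key]
  rcases eq_or_ne ((A : ℤ) - B) 0 with h0 | h0
  · left
    simp [h0]
  · right
    have h0' : (((A : ℤ) - B : ℤ) : ℚ) ≠ 0 := Int.cast_ne_zero.mpr h0
    have hC0' : (C : ℚ) ≠ 0 := Nat.cast_ne_zero.mpr hC0
    rw [padicValRat.div (mul_ne_zero hC0' h0') (Nat.cast_ne_zero.mpr (mul_ne_zero hD0 hB0)),
      padicValRat.mul hC0' h0', padicValRat.of_nat, padicValRat.of_nat, padicValRat.of_int,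
      padicValNat.eq_zero_of_not_dvd hC,
      padicValNat.eq_zero_of_not_dvd fun hd => (hp.dvd_mul.mp hd).elim hD hB]
    have := (padicValInt_dvd_iff (p := p) (2 * n + 1) _).mp hdvd
    have := this.resolve_left h0
    push_cast
    omega
end

section
/- For every prime p, the hypergeometric sum S_p := Σ_{k=0}^{p} C(p, k)^4 satisfies the identity in ℚ: S_p = 2 + Σ_{k=1}^{p−1} (p^4/k^4) · ( Σ_{n=0}^{k−1} (−p)^n · H_{k−1}(1^n) )^4. -/
/-- Multiple harmonic sum `H_N(s₁,…,s_k)`. -/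
def mhs : ℕ → List ℕ → ℚ
  | _, [] => 1
  | N, s :: t => ∑ n ∈ Finset.Icc 1 N, (1 / (n : ℚ) ^ s) * mhs (n - 1) t

theorem mhs_succ_replicate_succ (N n : ℕ) :
    mhs (N + 1) (List.replicate (n + 1) 1) =
      mhs N (List.replicate (n + 1) 1) + 1 / ((N : ℚ) + 1) * mhs N (List.replicate n 1) := by
  simp only [List.replicate_succ, mhs]
  rw [Finset.sum_Icc_succ_top (by omega)]
  simp

theorem mhs_replicate_eq_zero {N n : ℕ} (h : N < n) : mhs N (List.replicate n 1) = 0 := by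
  induction N generalizing n with
  | zero =>
    obtain ⟨m, rfl⟩ := Nat.exists_eq_succ_of_ne_zero h.ne'
    simp [List.replicate_succ, mhs]
  | succ N ih =>
    obtain ⟨m, rfl⟩ := Nat.exists_eq_succ_of_ne_zero (Nat.ne_zero_of_lt h)
    rw [Nat.succ_eq_add_one, mhs_succ_replicate_succ, ih (by omega), ih (by omega)]
    simp

/-- The multiple harmonic sums `H_N(1^n)` are the coefficients of `∏_{j=1}^N (1 + x/j)`. -/
theorem sum_pow_mul_mhs_replicate (x : ℚ) (N : ℕ) :
    ∑ n ∈ Finset.range (N + 1), x ^ n * mhs N (List.replicate n 1) =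
      ∏ j ∈ Finset.range N, (1 + x / ((j : ℚ) + 1)) := by
  induction N with
  | zero => simp [mhs]
  | succ N ih =>
    have shift : ∑ n ∈ Finset.range (N + 1), x ^ (n + 1) * mhs N (List.replicate (n + 1) 1) + 1 =
        ∑ n ∈ Finset.range (N + 1), x ^ n * mhs N (List.replicate n 1) := by
      have h := Finset.sum_range_succ' (fun n => x ^ n * mhs N (List.replicate n 1)) (N + 1)
      rw [Finset.sum_range_succ, mhs_replicate_eq_zero (Nat.lt_succ_self N)] at h
      simpa [mhs] using h.symm
    rw [Finset.sum_range_succ', Finset.prod_range_succ, ← ih, mul_add, mul_one]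
    simp only [mhs_succ_replicate_succ, mul_add, Finset.sum_add_distrib]
    have tail : ∀ n, x ^ (n + 1) * (1 / ((N : ℚ) + 1) * mhs N (List.replicate n 1)) =
        x ^ n * mhs N (List.replicate n 1) * (x / ((N : ℚ) + 1)) := fun n => by ring
    simp only [tail, List.replicate_zero, mhs, pow_zero, mul_one, ← Finset.sum_mul]
    linear_combination shift

theorem cast_choose_succ_eq_prod (p k : ℕ) :
    (p.choose (k + 1) : ℚ) = p / ((k : ℚ) + 1) *
      ((-1) ^ k * ∏ j ∈ Finset.range k, (1 + -(p : ℚ) / ((j : ℚ) + 1))) := by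
  induction k with
  | zero => simp
  | succ k ih =>
    have step : (p.choose (k + 1 + 1) : ℚ) * ((k : ℚ) + 1 + 1) =
        p.choose (k + 1) * ((p : ℚ) - (k + 1)) := by
      rcases le_or_gt (k + 1) p with h | h
      · have := Nat.choose_succ_right_eq p (k + 1)
        rw [← Nat.cast_inj (R := ℚ)] at this
        push_cast [Nat.cast_sub h] at this
        exact this
      · simp [Nat.choose_eq_zero_of_lt h, Nat.choose_eq_zero_of_lt (Nat.lt_succ_of_lt h)]
    have hk : (k : ℚ) + 1 ≠ 0 := by positivity
    have hk' : (k : ℚ) + 1 + 1 ≠ 0 := by positivity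
    rw [eq_div_of_mul_eq hk' step, ih, Finset.prod_range_succ]
    push_cast
    field_simp
    ring

/-- For every prime `p`,
`∑_{k=0}^{p} C(p,k)^4 = 2 + ∑_{k=1}^{p−1} (p^4/k^4)·(∑_{n=0}^{k−1} (−p)^n H_{k−1}(1^n))^4`. -/
theorem sum_choose_pow_four_eq (p : ℕ) (hp : p.Prime) :
    ∑ k ∈ Finset.range (p + 1), (Nat.choose p k : ℚ) ^ 4 =
      2 + ∑ k ∈ Finset.Icc 1 (p - 1), ((p : ℚ) ^ 4 / (k : ℚ) ^ 4) *
        (∑ n ∈ Finset.range k, (-(p : ℚ)) ^ n * mhs (k - 1) (List.replicate n 1)) ^ 4 := by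
  obtain ⟨q, rfl⟩ := Nat.exists_eq_succ_of_ne_zero hp.ne_zero
  rw [Nat.succ_eq_add_one, Finset.sum_range_succ, Finset.sum_range_succ', Nat.add_sub_cancel,
    ← Finset.Ico_add_one_right_eq_Icc, Finset.sum_Ico_eq_sum_range, Nat.add_sub_cancel]
  have term : ∀ k, ((q + 1).choose (k + 1) : ℚ) ^ 4 =
      (((q + 1 : ℕ) : ℚ) ^ 4 / ((1 + k : ℕ) : ℚ) ^ 4) *
        (∑ n ∈ Finset.range (1 + k), (-((q + 1 : ℕ) : ℚ)) ^ n *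
          mhs (1 + k - 1) (List.replicate n 1)) ^ 4 := fun k => by
    rw [Nat.add_comm 1 k, Nat.add_sub_cancel, sum_pow_mul_mhs_replicate,
      cast_choose_succ_eq_prod, mul_pow, mul_pow, div_pow, ← pow_mul, mul_comm k 4, pow_mul]
    norm_num
  rw [Finset.sum_congr rfl fun k _ => term k]
  simp only [Nat.choose_zero_right, Nat.choose_self, Nat.cast_one, one_pow]
  ring
end

section
/- For all sufficiently large primes p, the rational number S_p − 2 + (16/5)·p^5·B_{p−5} is either zero or has p-adic valuation at least 6 (i.e. S_p ≡ 2 − (16/5)·p^5·B_{p−5} mod p^6), where S_p := Σ_{k=0}^{p} C(p, k)^4 and B_{p−5} is the (p−5)-th Bernoulli number. -/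
open Finset

/-- The rational numbers of `p`-adic valuation at least `m`, as an additive subgroup of `ℚ`. -/
def padicBall (p : ℕ) [Fact p.Prime] (m : ℕ) : AddSubgroup ℚ where
  carrier := {x | padicNorm p x ≤ (p : ℚ) ^ (-(m : ℤ))}
  zero_mem' := by
    simp only [Set.mem_ofPred_eq, padicNorm.zero]
    positivity
  add_mem' hx hy := padicNorm.nonarchimedean.trans (max_le hx hy)
  neg_mem' hx := by simpa using hx

section padicBall

variable {p : ℕ} [hp : Fact p.Prime]

theorem mem_padicBall {m : ℕ} {x : ℚ} :
    x ∈ padicBall p m ↔ padicNorm p x ≤ (p : ℚ) ^ (-(m : ℤ)) := Iff.rfl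

attribute [irreducible] padicBall

theorem mul_mem_padicBall {a b : ℕ} {x y : ℚ} (hx : x ∈ padicBall p a)
    (hy : y ∈ padicBall p b) : x * y ∈ padicBall p (a + b) := by
  have hp0 : (p : ℚ) ≠ 0 := mod_cast hp.out.ne_zero
  rw [mem_padicBall] at *
  rw [padicNorm.mul, Nat.cast_add, neg_add, zpow_add₀ hp0]
  exact mul_le_mul hx hy (padicNorm.nonneg _) (by positivity)

theorem padicBall_anti {a b : ℕ} (h : a ≤ b) {x : ℚ} (hx : x ∈ padicBall p b) :
    x ∈ padicBall p a := by
  rw [mem_padicBall] at *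
  refine hx.trans (zpow_le_zpow_right₀ (mod_cast hp.out.one_le) (by omega))

theorem prime_pow_mem_padicBall (m : ℕ) : (p : ℚ) ^ m ∈ padicBall p m := by
  have hp0 : (p : ℚ) ^ m ≠ 0 := pow_ne_zero _ (mod_cast hp.out.ne_zero)
  rw [mem_padicBall, padicNorm.eq_zpow_of_nonzero hp0, padicValRat.pow,
    padicValRat.self hp.out.one_lt, mul_one]

theorem intCast_mem_padicBall_zero (z : ℤ) : (z : ℚ) ∈ padicBall p 0 := by
  simpa [mem_padicBall] using padicNorm.of_int z

theorem natCast_mem_padicBall_zero (n : ℕ) : (n : ℚ) ∈ padicBall p 0 :=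
  mod_cast intCast_mem_padicBall_zero (n : ℤ)

theorem one_mem_padicBall_zero : (1 : ℚ) ∈ padicBall p 0 := by
  simpa using natCast_mem_padicBall_zero (p := p) 1

theorem intCast_mem_padicBall_one {z : ℤ} (h : (p : ℤ) ∣ z) : (z : ℚ) ∈ padicBall p 1 := by
  obtain ⟨c, rfl⟩ := h
  have := mul_mem_padicBall (prime_pow_mem_padicBall (p := p) 1) (intCast_mem_padicBall_zero c)
  simpa using this

theorem inv_natCast_mem_padicBall_zero {k : ℕ} (h0 : 0 < k) (hk : k < p) :
    (k : ℚ)⁻¹ ∈ padicBall p 0 := by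
  have : padicNorm p (k : ℚ) = 1 :=
    (padicNorm.nat_eq_one_iff k).2 (Nat.not_dvd_of_pos_of_lt h0 hk)
  have hmul : padicNorm p ((k : ℚ)⁻¹ * k) = 1 := by
    rw [inv_mul_cancel₀ (mod_cast h0.ne'), padicNorm.one]
  rw [padicNorm.mul, this, mul_one] at hmul
  simp [mem_padicBall, hmul]

theorem pow_mem_padicBall_zero {x : ℚ} (hx : x ∈ padicBall p 0) (n : ℕ) :
    x ^ n ∈ padicBall p 0 := by
  induction n with
  | zero => simpa using one_mem_padicBall_zero
  | succ n ih => rw [pow_succ]; exact mul_mem_padicBall ih hx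

theorem eq_zero_or_le_padicValRat_of_mem_padicBall {m : ℕ} {x : ℚ} (hx : x ∈ padicBall p m) :
    x = 0 ∨ (m : ℤ) ≤ padicValRat p x := by
  by_cases h : x = 0
  · exact Or.inl h
  · right
    rw [mem_padicBall, padicNorm.eq_zpow_of_nonzero h,
      zpow_le_zpow_iff_right₀ (mod_cast hp.out.one_lt)] at hx
    omega

end padicBall

/-- The generalized harmonic number `∑_{j=1}^{n} 1 / j ^ m`. -/
def powHarmonic (m n : ℕ) : ℚ := ∑ j ∈ range n, ((j + 1 : ℕ) : ℚ)⁻¹ ^ m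

theorem powHarmonic_succ (m n : ℕ) :
    powHarmonic m (n + 1) = powHarmonic m n + ((n + 1 : ℕ) : ℚ)⁻¹ ^ m :=
  sum_range_succ _ _

/-- The alternating binomial sum `∑_{k=1}^{n} (-1)^(k-1) C(n, k) / k ^ m`. -/
def altChooseSum (m n : ℕ) : ℚ :=
  ∑ k ∈ range n, (-1) ^ k * (n.choose (k + 1) : ℚ) * ((k + 1 : ℕ) : ℚ)⁻¹ ^ m

theorem altChooseSum_zero_succ (n : ℕ) : altChooseSum 0 (n + 1) = 1 := by
  have h := Int.alternating_sum_range_choose_of_ne (n := n + 1) (by omega)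
  rw [sum_range_succ'] at h
  have h' := congrArg (Int.cast : ℤ → ℚ) h
  push_cast at h'
  simp only [altChooseSum, pow_zero, mul_one]
  simp only [pow_succ, mul_neg, mul_one, neg_mul, sum_neg_distrib] at h'
  simp at h'
  linarith

theorem altChooseSum_succ (m n : ℕ) :
    altChooseSum (m + 1) (n + 1) =
      altChooseSum (m + 1) n + ((n + 1 : ℕ) : ℚ)⁻¹ * altChooseSum m (n + 1) := by
  have h : altChooseSum (m + 1) n =
      ∑ k ∈ range (n + 1), (-1) ^ k * (n.choose (k + 1) : ℚ) * ((k + 1 : ℕ) : ℚ)⁻¹ ^ (m + 1) := by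
    rw [sum_range_succ]
    simp [altChooseSum]
  rw [h, altChooseSum, altChooseSum, mul_sum, ← sum_add_distrib]
  refine sum_congr rfl fun k _ ↦ ?_
  have h1 : ((n + 1 : ℕ) : ℚ) * n.choose k = (n + 1).choose (k + 1) * ((k + 1 : ℕ) : ℚ) :=
    mod_cast Nat.add_one_mul_choose_eq n k
  have h2 : ((n + 1).choose (k + 1) : ℚ) = n.choose k + n.choose (k + 1) :=
    mod_cast Nat.choose_succ_succ n k
  have hn : ((n + 1 : ℕ) : ℚ) ≠ 0 := mod_cast n.succ_ne_zero
  have hk : ((k + 1 : ℕ) : ℚ) ≠ 0 := mod_cast k.succ_ne_zero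
  have h3 : (n.choose k : ℚ) * ((k + 1 : ℕ) : ℚ)⁻¹ =
      ((n + 1 : ℕ) : ℚ)⁻¹ * (n + 1).choose (k + 1) := by
    field_simp
    linarith
  linear_combination (-1) ^ k * ((k + 1 : ℕ) : ℚ)⁻¹ ^ (m + 1) * h2 +
    (-1) ^ k * ((k + 1 : ℕ) : ℚ)⁻¹ ^ m * h3

theorem altChooseSum_one (n : ℕ) : altChooseSum 1 n = powHarmonic 1 n := by
  induction n with
  | zero => simp [altChooseSum, powHarmonic]
  | succ n ih => rw [altChooseSum_succ, powHarmonic_succ, ih, altChooseSum_zero_succ]; ring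

theorem altChooseSum_two (n : ℕ) :
    altChooseSum 2 n = (powHarmonic 1 n ^ 2 + powHarmonic 2 n) / 2 := by
  induction n with
  | zero => simp [altChooseSum, powHarmonic]
  | succ n ih =>
    rw [altChooseSum_succ, altChooseSum_one, ih]
    simp only [powHarmonic_succ]
    ring

theorem altChooseSum_three (n : ℕ) :
    altChooseSum 3 n = powHarmonic 1 n ^ 3 / 6 + powHarmonic 1 n * powHarmonic 2 n / 2 +
      powHarmonic 3 n / 3 := by
  induction n with
  | zero => simp [altChooseSum, powHarmonic]
  | succ n ih =>
    rw [altChooseSum_succ, altChooseSum_two, ih]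
    simp only [powHarmonic_succ]
    ring

theorem altChooseSum_four (n : ℕ) :
    altChooseSum 4 n = powHarmonic 1 n ^ 4 / 24 + powHarmonic 1 n ^ 2 * powHarmonic 2 n / 4 +
      powHarmonic 2 n ^ 2 / 8 + powHarmonic 1 n * powHarmonic 3 n / 3 + powHarmonic 4 n / 4 := by
  induction n with
  | zero => simp [altChooseSum, powHarmonic]
  | succ n ih =>
    rw [altChooseSum_succ, altChooseSum_three, ih]
    simp only [powHarmonic_succ]
    ring

section congruences

variable {p : ℕ} [hp : Fact p.Prime]

theorem powHarmonic_mem_padicBall_zero (m : ℕ) {n : ℕ} (hn : n < p) :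
    powHarmonic m n ∈ padicBall p 0 :=
  sum_mem fun j hj ↦ pow_mem_padicBall_zero
    (inv_natCast_mem_padicBall_zero j.succ_pos (by have := mem_range.1 hj; omega)) m

theorem neg_one_pow_mul_choose_sub_mem {k : ℕ} (hk : k < p) :
    (-1 : ℚ) ^ k * ((p - 1).choose k : ℚ) - (1 - p * powHarmonic 1 k) ∈ padicBall p 2 := by
  induction k with
  | zero => simp [powHarmonic, zero_mem]
  | succ k ih =>
    have hH := powHarmonic_mem_padicBall_zero 1 (n := k) (p := p) (by omega)
    have hinv := inv_natCast_mem_padicBall_zero (p := p) k.succ_pos hk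
    have hstep : ((p - 1).choose (k + 1) : ℚ) * ((k + 1 : ℕ) : ℚ) =
        (p - 1).choose k * (p - ((k + 1 : ℕ) : ℚ)) := by
      have h := Nat.choose_succ_right_eq (p - 1) k
      have h2 := congrArg (Nat.cast : ℕ → ℚ) h
      rw [Nat.cast_mul, Nat.cast_mul, show p - 1 - k = p - (k + 1) by omega,
        Nat.cast_sub hk.le] at h2
      exact h2
    have hk0 : ((k + 1 : ℕ) : ℚ) ≠ 0 := mod_cast k.succ_ne_zero
    have hstep' : ((p - 1).choose (k + 1) : ℚ) =
        (p - 1).choose k * (p * ((k + 1 : ℕ) : ℚ)⁻¹ - 1) := by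
      field_simp
      linarith
    have h1 : 1 - (p : ℚ) * ((k + 1 : ℕ) : ℚ)⁻¹ ∈ padicBall p 0 :=
      sub_mem one_mem_padicBall_zero
        (mul_mem_padicBall (natCast_mem_padicBall_zero p) hinv)
    have h2 := mul_mem_padicBall (ih (by omega)) h1
    have h3 := mul_mem_padicBall (prime_pow_mem_padicBall (p := p) 2) (mul_mem_padicBall hH hinv)
    convert add_mem h2 h3 using 1
    rw [hstep', powHarmonic_succ]
    ring

theorem pow_sub_one_sub_one_mem {k : ℕ} (h0 : 0 < k) (hk : k < p) :
    (k : ℚ) ^ (p - 1) - 1 ∈ padicBall p 1 := by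
  have hcop : IsCoprime (k : ℤ) p :=
    Nat.isCoprime_iff_coprime.2 (Nat.coprime_of_lt_prime h0.ne' hk hp.out).symm
  have h := (Int.ModEq.pow_card_sub_one_eq_one hp.out hcop).symm.dvd
  exact_mod_cast intCast_mem_padicBall_one h

theorem sum_pow_mem_padicBall_one {e : ℕ} (h0 : 0 < e) (he : e < p - 1) :
    ∑ k ∈ range (p - 1), ((k + 1 : ℕ) : ℚ) ^ e ∈ padicBall p 1 := by
  have h : (p : ℤ) ∣ ∑ k ∈ range p, (k : ℤ) ^ e := by
    rw [← ZMod.intCast_zmod_eq_zero_iff_dvd]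
    have := FiniteField.sum_pow_lt_card_sub_one (ZMod p) e (by simpa [ZMod.card] using he)
    rw [← this, Int.cast_sum]
    refine sum_bij (fun k _ ↦ (k : ZMod p)) (fun _ _ ↦ mem_univ _) (fun a ha b hb hab ↦ ?_)
      (fun x _ ↦ ⟨x.val, mem_range.2 x.val_lt, ZMod.natCast_zmod_val x⟩) (fun k _ ↦ by simp)
    rw [← ZMod.val_cast_of_lt (mem_range.1 ha), hab, ZMod.val_cast_of_lt (mem_range.1 hb)]
  have h' := intCast_mem_padicBall_one h
  rw [show range p = range (p - 1 + 1) by rw [Nat.sub_add_cancel hp.out.one_le],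
    sum_range_succ'] at h'
  simpa [h0.ne'] using h'

theorem inv_pow_sub_pow_mem {m k : ℕ} (hm : m ≤ p - 1) (h0 : 0 < k) (hk : k < p) :
    (k : ℚ)⁻¹ ^ m - (k : ℚ) ^ (p - 1 - m) ∈ padicBall p 1 := by
  have hk0 : (k : ℚ) ≠ 0 := mod_cast h0.ne'
  have h := mul_mem_padicBall (pow_sub_one_sub_one_mem h0 hk)
    (pow_mem_padicBall_zero (inv_natCast_mem_padicBall_zero h0 hk) m)
  convert neg_mem h using 1
  have : (k : ℚ) ^ (p - 1) = k ^ (p - 1 - m) * k ^ m := by rw [← pow_add]; congr 1; omega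
  rw [this]
  have : (k : ℚ) ^ m * (k : ℚ)⁻¹ ^ m = 1 := by rw [← mul_pow, mul_inv_cancel₀ hk0, one_pow]
  linear_combination (k : ℚ) ^ (p - 1 - m) * this

theorem powHarmonic_mem_padicBall_one {m : ℕ} (h0 : 0 < m) (hm : m < p - 1) :
    powHarmonic m (p - 1) ∈ padicBall p 1 := by
  have h1 := sum_pow_mem_padicBall_one (p := p) (e := p - 1 - m) (by omega) (by omega)
  have h2 : ∑ k ∈ range (p - 1),
      (((k + 1 : ℕ) : ℚ)⁻¹ ^ m - ((k + 1 : ℕ) : ℚ) ^ (p - 1 - m)) ∈ padicBall p 1 :=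
    sum_mem fun k hk ↦ inv_pow_sub_pow_mem hm.le k.succ_pos (by have := mem_range.1 hk; omega)
  convert add_mem h2 h1 using 1
  rw [sum_sub_distrib, sub_add_cancel, powHarmonic]

theorem bernoulli'_mem_padicBall_zero {n : ℕ} (hn : n + 1 < p) :
    bernoulli' n ∈ padicBall p 0 := by
  induction n using Nat.strong_induction_on with
  | _ n ih =>
    rw [bernoulli'_def]
    refine sub_mem one_mem_padicBall_zero (sum_mem fun k hk ↦ ?_)
    have hk' := mem_range.1 hk
    have hinv := inv_natCast_mem_padicBall_zero (p := p) (k := n - k + 1) (by omega) (by omega)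
    have h := mul_mem_padicBall (mul_mem_padicBall (natCast_mem_padicBall_zero (n.choose k)) hinv)
      (ih k hk' (by omega))
    convert h using 1
    push_cast [hk'.le]
    rw [div_eq_mul_inv]

theorem bernoulli_mem_padicBall_zero {n : ℕ} (hn : n + 1 < p) :
    bernoulli n ∈ padicBall p 0 := by
  have h := mul_mem_padicBall (intCast_mem_padicBall_zero (p := p) ((-1) ^ n))
    (bernoulli'_mem_padicBall_zero hn)
  simpa [bernoulli] using h

/-- The double harmonic sum `∑_{0 < j < k ≤ n} 1 / (j k ^ 4)`. -/
def doubleHarmonicOneFour (n : ℕ) : ℚ :=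
  ∑ k ∈ range n, powHarmonic 1 k * ((k + 1 : ℕ) : ℚ)⁻¹ ^ 4

theorem powHarmonic_one_sub_faulhaber_mem (hp3 : 3 ≤ p) {k : ℕ} (hk : k < p) :
    powHarmonic 1 k - ∑ i ∈ range (p - 1),
      bernoulli i * (p - 1).choose i * ((k + 1 : ℕ) : ℚ) ^ (p - 1 - i) / ((p - 1 : ℕ) : ℚ) ∈
      padicBall p 1 := by
  have hF := sum_range_pow (k + 1) (p - 2)
  rw [show p - 2 + 1 = p - 1 by omega, sum_range_succ'] at hF
  have hc : ((p - 2 : ℕ) : ℚ) + 1 = ((p - 1 : ℕ) : ℚ) := by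
    rw [show p - 1 = p - 2 + 1 by omega]; push_cast; rfl
  rw [hc] at hF
  rw [← hF, Nat.cast_zero, zero_pow (by omega), add_zero, powHarmonic, ← sum_sub_distrib]
  refine sum_mem fun j hj ↦ ?_
  have := mem_range.1 hj
  simpa [show p - 1 - 1 = p - 2 by omega] using
    inv_pow_sub_pow_mem (p := p) (m := 1) (by omega) j.succ_pos (by omega)

theorem sum_pow_mul_inv_pow_four_mem (hp7 : 7 ≤ p) {e : ℕ} (h0 : 0 < e) (he : e ≤ p - 1)
    (h4 : e ≠ 4) :
    ∑ k ∈ range (p - 1), ((k + 1 : ℕ) : ℚ) ^ e * ((k + 1 : ℕ) : ℚ)⁻¹ ^ 4 ∈ padicBall p 1 := by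
  rcases lt_or_gt_of_ne h4 with h | h
  · convert powHarmonic_mem_padicBall_one (p := p) (m := 4 - e) (by omega) (by omega) using 1
    refine sum_congr rfl fun k _ ↦ ?_
    have hk : ((k + 1 : ℕ) : ℚ) ≠ 0 := mod_cast k.succ_ne_zero
    rw [← Nat.sub_add_cancel h.le, pow_add _ (4 - e), Nat.sub_add_cancel h.le, mul_left_comm,
      ← mul_pow, mul_inv_cancel₀ hk, one_pow, mul_one]
  · convert sum_pow_mem_padicBall_one (p := p) (e := e - 4) (by omega) (by omega) using 1
    refine sum_congr rfl fun k _ ↦ ?_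
    have hk : ((k + 1 : ℕ) : ℚ) ≠ 0 := mod_cast k.succ_ne_zero
    rw [← Nat.sub_add_cancel h.le, pow_add, Nat.sub_add_cancel h.le, mul_assoc,
      ← mul_pow, mul_inv_cancel₀ hk, one_pow, mul_one]

theorem doubleHarmonicOneFour_sub_bernoulli_mem (hp7 : 7 ≤ p) :
    doubleHarmonicOneFour (p - 1) - bernoulli (p - 5) ∈ padicBall p 1 := by
  set c : ℕ → ℚ := fun i ↦ bernoulli i * (p - 1).choose i * ((p - 1 : ℕ) : ℚ)⁻¹ with hc
  have hc0 : ∀ i < p - 1, c i ∈ padicBall p 0 := fun i hi ↦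
    mul_mem_padicBall (mul_mem_padicBall (bernoulli_mem_padicBall_zero (by omega))
      (natCast_mem_padicBall_zero _)) (inv_natCast_mem_padicBall_zero (by omega) (by omega))
  have hfaul : doubleHarmonicOneFour (p - 1) - ∑ i ∈ range (p - 1), c i *
      ∑ k ∈ range (p - 1), ((k + 1 : ℕ) : ℚ) ^ (p - 1 - i) * ((k + 1 : ℕ) : ℚ)⁻¹ ^ 4 ∈
      padicBall p 1 := by
    simp only [mul_sum]
    rw [sum_comm, doubleHarmonicOneFour, ← sum_sub_distrib]
    refine sum_mem fun k hk ↦ ?_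
    have hk' := mem_range.1 hk
    convert mul_mem_padicBall (powHarmonic_one_sub_faulhaber_mem (p := p) (k := k) (by omega)
      (by omega)) (pow_mem_padicBall_zero
      (inv_natCast_mem_padicBall_zero k.succ_pos (by omega)) 4) using 1
    rw [sub_mul, sum_mul]
    congr 1
    refine sum_congr rfl fun i _ ↦ ?_
    rw [hc]
    ring
  have hmem : p - 5 ∈ range (p - 1) := mem_range.2 (by omega)
  rw [← add_sum_erase _ _ hmem] at hfaul
  have hrest : ∑ i ∈ (range (p - 1)).erase (p - 5), c i *
      ∑ k ∈ range (p - 1), ((k + 1 : ℕ) : ℚ) ^ (p - 1 - i) * ((k + 1 : ℕ) : ℚ)⁻¹ ^ 4 ∈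
      padicBall p 1 := by
    refine sum_mem fun i hi ↦ ?_
    have hi1 := mem_range.1 (mem_of_mem_erase hi)
    have hi2 := ne_of_mem_erase hi
    simpa using mul_mem_padicBall (hc0 i hi1)
      (sum_pow_mul_inv_pow_four_mem hp7 (e := p - 1 - i) (by omega) (by omega) (by omega))
  have hmain : c (p - 5) * ∑ k ∈ range (p - 1),
      ((k + 1 : ℕ) : ℚ) ^ (p - 1 - (p - 5)) * ((k + 1 : ℕ) : ℚ)⁻¹ ^ 4 =
      bernoulli (p - 5) * (p - 1).choose 4 := by
    have hp1 : ((p - 1 : ℕ) : ℚ) ≠ 0 := by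
      rw [Nat.cast_ne_zero]; omega
    have hone : ∀ k ∈ range (p - 1),
        ((k + 1 : ℕ) : ℚ) ^ (p - 1 - (p - 5)) * ((k + 1 : ℕ) : ℚ)⁻¹ ^ 4 = 1 := fun k _ ↦ by
      have hk : ((k + 1 : ℕ) : ℚ) ≠ 0 := mod_cast k.succ_ne_zero
      rw [show p - 1 - (p - 5) = 4 by omega, ← mul_pow, mul_inv_cancel₀ hk, one_pow]
    rw [sum_congr rfl hone, sum_const, card_range, nsmul_one]
    simp only [hc]
    rw [Nat.choose_symm_of_eq_add (show p - 1 = (p - 5) + 4 by omega)]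
    field_simp
  rw [hmain] at hfaul
  have hch : ((p - 1).choose 4 : ℚ) - 1 ∈ padicBall p 1 := by
    have h1 := padicBall_anti one_le_two
      (neg_one_pow_mul_choose_sub_mem (p := p) (k := 4) (by omega))
    have h2 := mul_mem_padicBall (prime_pow_mem_padicBall (p := p) 1)
      (powHarmonic_mem_padicBall_zero (p := p) 1 (n := 4) (by omega))
    convert sub_mem h1 h2 using 1
    ring
  have hB := mul_mem_padicBall (bernoulli_mem_padicBall_zero (p := p) (n := p - 5) (by omega)) hch
  rw [zero_add] at hB
  convert add_mem (add_mem hfaul hrest) hB using 1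
  ring

theorem powHarmonic_four_sub_doubleHarmonic_mem (hp7 : 7 ≤ p) :
    powHarmonic 4 (p - 1) - (4 / 5 : ℚ) * p * doubleHarmonicOneFour (p - 1) ∈ padicBall p 2 := by
  have hH (m : ℕ) (h0 : 0 < m) (hm : m ≤ 5) :
      powHarmonic m (p - 1) ∈ padicBall p 1 := powHarmonic_mem_padicBall_one h0 (by omega)
  have hinv (k : ℕ) (h0 : 0 < k) (hk : k < 7) : (k : ℚ)⁻¹ ∈ padicBall p 0 :=
    inv_natCast_mem_padicBall_zero h0 (by omega)
  have hint (m : ℕ) : powHarmonic m (p - 1) ∈ padicBall p 0 :=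
    powHarmonic_mem_padicBall_zero m (by omega)
  -- `altChooseSum 4 (p - 1)` evaluated through the expansion of the binomial coefficients
  have hA : altChooseSum 4 (p - 1) + powHarmonic 4 (p - 1)
      - p * powHarmonic 5 (p - 1) - p * doubleHarmonicOneFour (p - 1) ∈ padicBall p 2 := by
    have h : ∑ k ∈ range (p - 1), -(((-1 : ℚ) ^ (k + 1) * ((p - 1).choose (k + 1) : ℚ)
        - (1 - p * powHarmonic 1 (k + 1))) * ((k + 1 : ℕ) : ℚ)⁻¹ ^ 4) ∈ padicBall p 2 := by
      refine sum_mem fun k hk ↦ neg_mem ?_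
      have hk' := mem_range.1 hk
      exact mul_mem_padicBall (neg_one_pow_mul_choose_sub_mem (by omega))
        (pow_mem_padicBall_zero (inv_natCast_mem_padicBall_zero k.succ_pos (by omega)) 4)
    convert h using 1
    simp only [altChooseSum, doubleHarmonicOneFour, mul_sum]
    rw [powHarmonic, powHarmonic, mul_sum, ← sum_add_distrib, ← sum_sub_distrib,
      ← sum_sub_distrib]
    refine sum_congr rfl fun k _ ↦ ?_
    rw [powHarmonic_succ]
    ring
  have hpH5 := mul_mem_padicBall (prime_pow_mem_padicBall (p := p) 1)
    (hH 5 (by omega) (by omega))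
  have h24 : (24 : ℚ)⁻¹ ∈ padicBall p 0 := by
    convert mul_mem_padicBall (hinv 4 (by omega) (by omega)) (hinv 6 (by omega) (by omega)) using 1
    norm_num
  have h8 : (8 : ℚ)⁻¹ ∈ padicBall p 0 := by
    convert mul_mem_padicBall (hinv 2 (by omega) (by omega)) (hinv 4 (by omega) (by omega)) using 1
    norm_num
  have h45 : (4 / 5 : ℚ) ∈ padicBall p 0 := by
    simpa [div_eq_mul_inv] using
      mul_mem_padicBall (natCast_mem_padicBall_zero 4) (hinv 5 (by omega) (by omega))
  have h11 := mul_mem_padicBall (hH 1 (by omega) (by omega)) (hH 1 (by omega) (by omega))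
  have h22 := mul_mem_padicBall (hH 2 (by omega) (by omega)) (hH 2 (by omega) (by omega))
  have h13 := mul_mem_padicBall (hH 1 (by omega) (by omega)) (hH 3 (by omega) (by omega))
  have t1 := mul_mem_padicBall (mul_mem_padicBall h11 (pow_mem_padicBall_zero (hint 1) 2)) h24
  have t2 := mul_mem_padicBall (mul_mem_padicBall h11 (hint 2)) (hinv 4 (by omega) (by omega))
  have t3 := mul_mem_padicBall h22 h8
  have t4 := mul_mem_padicBall h13 (hinv 3 (by omega) (by omega))
  have hsum := mul_mem_padicBall h45 (sub_mem (add_mem hA hpH5)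
    (add_mem (add_mem t1 t2) (add_mem t3 t4)))
  rw [zero_add] at hsum
  convert hsum using 1
  rw [altChooseSum_four]
  push_cast
  ring

theorem choose_pow_four_sub_mem {k : ℕ} (hk : k < p) :
    ((p - 1).choose k : ℚ) ^ 4 - (1 - 4 * p * powHarmonic 1 k) ∈ padicBall p 2 := by
  have hE := neg_one_pow_mul_choose_sub_mem (p := p) hk
  have hH := powHarmonic_mem_padicBall_zero (p := p) 1 hk
  have hp0 := natCast_mem_padicBall_zero (p := p) p
  have hx : (-1 : ℚ) ^ k * ((p - 1).choose k : ℚ) ∈ padicBall p 0 := by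
    simpa using mul_mem_padicBall (intCast_mem_padicBall_zero (p := p) ((-1) ^ k))
      (natCast_mem_padicBall_zero ((p - 1).choose k))
  have hpow : ((p - 1).choose k : ℚ) ^ 4 = ((-1 : ℚ) ^ k * ((p - 1).choose k : ℚ)) ^ 4 := by
    rw [mul_pow, ← pow_mul, mul_comm k 4, pow_mul]
    norm_num
  rw [hpow]
  generalize (-1 : ℚ) ^ k * ((p - 1).choose k : ℚ) = x at *
  have hpH := mul_mem_padicBall hp0 hH
  have hy : 1 - (p : ℚ) * powHarmonic 1 k ∈ padicBall p 0 := sub_mem one_mem_padicBall_zero hpH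
  have h1 := mul_mem_padicBall (mul_mem_padicBall hE (add_mem hx hy))
    (add_mem (pow_mem_padicBall_zero hx 2) (pow_mem_padicBall_zero hy 2))
  have h2 := mul_mem_padicBall (mul_mem_padicBall (prime_pow_mem_padicBall (p := p) 2)
    (pow_mem_padicBall_zero hH 2)) (add_mem (sub_mem (natCast_mem_padicBall_zero (p := p) 6)
      (mul_mem_padicBall (natCast_mem_padicBall_zero (p := p) 4) hpH))
      (pow_mem_padicBall_zero hpH 2))
  convert add_mem h1 h2 using 1
  push_cast
  ring

theorem sum_choose_pow_four_eq_s6 :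
    ∑ k ∈ range (p + 1), (p.choose k : ℚ) ^ 4 =
      2 + (p : ℚ) ^ 4 *
        ∑ k ∈ range (p - 1), ((p - 1).choose k : ℚ) ^ 4 * ((k + 1 : ℕ) : ℚ)⁻¹ ^ 4 := by
  obtain ⟨n, hn⟩ : ∃ n, p = n + 1 := ⟨p - 1, by have := hp.out.one_le; omega⟩
  rw [sum_range_succ, hn, sum_range_succ', Nat.add_sub_cancel, mul_sum]
  have : ∀ k ∈ range n, ((n + 1).choose (k + 1) : ℚ) ^ 4 =
      ((n + 1 : ℕ) : ℚ) ^ 4 * ((n.choose k : ℚ) ^ 4 * ((k + 1 : ℕ) : ℚ)⁻¹ ^ 4) := fun k _ ↦ by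
    have h1 : ((n + 1 : ℕ) : ℚ) * n.choose k = (n + 1).choose (k + 1) * ((k + 1 : ℕ) : ℚ) :=
      mod_cast Nat.add_one_mul_choose_eq n k
    have hk : ((k + 1 : ℕ) : ℚ) ≠ 0 := mod_cast k.succ_ne_zero
    rw [← mul_pow, ← mul_pow, ← mul_assoc, h1, mul_inv_cancel_right₀ hk]
  rw [sum_congr rfl this]
  simp
  ring

theorem sum_choose_pow_four_sub_mem (hp7 : 7 ≤ p) :
    ∑ k ∈ range (p + 1), (p.choose k : ℚ) ^ 4 - 2
      + (16 / 5 : ℚ) * (p : ℚ) ^ 5 * bernoulli (p - 5) ∈ padicBall p 6 := by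
  have hsum : ∑ k ∈ range (p - 1), ((p - 1).choose k : ℚ) ^ 4 * ((k + 1 : ℕ) : ℚ)⁻¹ ^ 4
      - (powHarmonic 4 (p - 1) - 4 * p * doubleHarmonicOneFour (p - 1)) ∈ padicBall p 2 := by
    rw [powHarmonic, doubleHarmonicOneFour, mul_sum, ← sum_sub_distrib, ← sum_sub_distrib]
    refine sum_mem fun k hk ↦ ?_
    have hk' := mem_range.1 hk
    convert mul_mem_padicBall (choose_pow_four_sub_mem (p := p) (k := k) (by omega))
      (pow_mem_padicBall_zero (inv_natCast_mem_padicBall_zero k.succ_pos (by omega)) 4) using 1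
    ring
  have h165 : (16 / 5 : ℚ) ∈ padicBall p 0 := by
    simpa [div_eq_mul_inv] using mul_mem_padicBall (natCast_mem_padicBall_zero 16)
      (inv_natCast_mem_padicBall_zero (p := p) (k := 5) (by omega) (by omega))
  have h1 := mul_mem_padicBall (prime_pow_mem_padicBall (p := p) 4)
    (add_mem hsum (powHarmonic_four_sub_doubleHarmonic_mem hp7))
  have h2 := mul_mem_padicBall (mul_mem_padicBall h165 (prime_pow_mem_padicBall (p := p) 5))
    (doubleHarmonicOneFour_sub_bernoulli_mem hp7)
  convert sub_mem h1 h2 using 1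
  rw [sum_choose_pow_four_eq_s6]
  ring

end congruences

/-- For all sufficiently large primes `p`,
`∑_{k=0}^{p} C(p,k)^4 ≡ 2 − (16/5)·p^5·B_{p−5} (mod p^6)`. -/
theorem sum_choose_pow_four_bernoulli_supercongruence :
    ∃ N : ℕ, ∀ p : ℕ, p.Prime → N ≤ p →
      (∑ k ∈ Finset.range (p + 1), (Nat.choose p k : ℚ) ^ 4)
          - 2 + (16 / 5 : ℚ) * (p : ℚ) ^ 5 * bernoulli (p - 5) = 0 ∨
      (6 : ℤ) ≤ padicValRat p
        ((∑ k ∈ Finset.range (p + 1), (Nat.choose p k : ℚ) ^ 4)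
          - 2 + (16 / 5 : ℚ) * (p : ℚ) ^ 5 * bernoulli (p - 5)) := by
  refine ⟨7, fun p hp hp7 ↦ ?_⟩
  have : Fact p.Prime := ⟨hp⟩
  exact_mod_cast eq_zero_or_le_padicValRat_of_mem_padicBall (sum_choose_pow_four_sub_mem hp7)
end
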